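/- arXiv:quant-ph/0411115 — 2 statements merged into one kernel-verified Lean document; each statement's English description precedes it below -/
import Mathlib

section
/- Let |ψ⟩ be a fully entangled stabilizer state on n ≥ 2 qubits. Then for every qubit index i ∈ {1,…,n} and every u ∈ {x,y,z}, there exists an element M ∈ 𝒮(ψ) whose i-th tensor factor equals σ_u; that is, all three Pauli matrices σₓ, σ_y, σ_z occur on every qubit in 𝒮(ψ). -/
open Matrix

noncomputable section

/-- Pauli matrices: `0 ↦ σ₀` (identity), `1 ↦ σₓ`, `2 ↦ σ_y`, `3 ↦ σ_z`. -/
def pauliMat : Fin 4 → Matrix (Fin 2) (Fin 2) ℂ :=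
  ![1, !![0, 1; 1, 0], !![0, -Complex.I; Complex.I, 0], !![1, 0; 0, -1]]

/-- Tensor (Kronecker) product of a family of one-qubit operators, as an operator
on qubits indexed by `ι`. -/
def kron {ι : Type} [Fintype ι] (U : ι → Matrix (Fin 2) (Fin 2) ℂ) :
    Matrix (ι → Fin 2) (ι → Fin 2) ℂ :=
  Matrix.of fun x y => ∏ i, U i (x i) (y i)

/-- An element of the Pauli group: a phase in `{1, -1, i, -i}` together with a
Pauli label (`σ₀, σₓ, σ_y, σ_z`) on every qubit. -/
structure PauliOp (ι : Type) where
  phase : ℂ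
  label : ι → Fin 4
  phase_ok : phase = 1 ∨ phase = -1 ∨ phase = Complex.I ∨ phase = -Complex.I

noncomputable instance {ι : Type} : DecidableEq (PauliOp ι) := Classical.decEq _

/-- The matrix of a Pauli group element. -/
def PauliOp.toMatrix {ι : Type} [Fintype ι] (M : PauliOp ι) :
    Matrix (ι → Fin 2) (ι → Fin 2) ℂ :=
  M.phase • kron fun i => pauliMat (M.label i)

/-- The support of a Pauli operator: the set of qubits on which it acts nontrivially. -/
def PauliOp.support {ι : Type} [Fintype ι] [DecidableEq ι] (M : PauliOp ι) : Finset ι :=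
  Finset.univ.filter fun i => M.label i ≠ 0

/-- A (maximal) stabilizer on the qubits indexed by `ι`: an abelian subgroup of the
Pauli group of cardinality `2^|ι|` which does not contain `-I`. -/
structure Stabilizer (ι : Type) [Fintype ι] [DecidableEq ι] where
  elems : Finset (PauliOp ι)
  one_mem : ∃ M ∈ elems, PauliOp.toMatrix M = 1
  mul_mem : ∀ M ∈ elems, ∀ N ∈ elems, ∃ K ∈ elems,
    PauliOp.toMatrix K = PauliOp.toMatrix M * PauliOp.toMatrix N
  comm : ∀ M ∈ elems, ∀ N ∈ elems,
    PauliOp.toMatrix M * PauliOp.toMatrix N = PauliOp.toMatrix N * PauliOp.toMatrix M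
  neg_one_not_mem : ∀ M ∈ elems, PauliOp.toMatrix M ≠ -1
  card_elems : elems.card = 2 ^ Fintype.card ι

variable {ι : Type} [Fintype ι] [DecidableEq ι]

/-- `ψ` is the stabilizer state of the stabilizer `S`: it is a unit vector fixed by
every element of `S`. -/
def stabilizesState (S : Stabilizer ι) (ψ : (ι → Fin 2) → ℂ) : Prop :=
  (∑ x, Complex.normSq (ψ x)) = 1 ∧ ∀ M ∈ S.elems, (PauliOp.toMatrix M).mulVec ψ = ψ

/-- `ψ` is a stabilizer state. -/
def IsStabilizerState (ψ : (ι → Fin 2) → ℂ) : Prop :=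
  ∃ S : Stabilizer ι, stabilizesState S ψ

/-- `A_ω(ψ)`: the number of stabilizer elements with support exactly `ω`. -/
def Aomega (S : Stabilizer ι) (ω : Finset ι) : ℕ :=
  (S.elems.filter fun M => PauliOp.support M = ω).card

/-- `ω` is a minimal support of `S`: it is the support of some element of `S`, and no
element of `S` has nonempty support strictly contained in `ω`. -/
def IsMinimalSupport (S : Stabilizer ι) (ω : Finset ι) : Prop :=
  (∃ M ∈ S.elems, PauliOp.support M = ω) ∧
    ∀ M ∈ S.elems, PauliOp.support M ⊂ ω → PauliOp.support M = ∅

/-- The matrices of the minimal elements of `S` (the elements whose support is a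
minimal support). -/
def minimalMatrices (S : Stabilizer ι) : Set (Matrix (ι → Fin 2) (ι → Fin 2) ℂ) :=
  {A | ∃ M ∈ S.elems, IsMinimalSupport S (PauliOp.support M) ∧ PauliOp.toMatrix M = A}

/-- `M` belongs to the subgroup `ℳ(ψ)` of `S` generated by the minimal elements.
(Every stabilizer element is an involution, so the generated submonoid coincides with
the generated subgroup.) -/
def inMinimalSubgroup (S : Stabilizer ι) (M : PauliOp ι) : Prop :=
  M ∈ S.elems ∧ PauliOp.toMatrix M ∈ Submonoid.closure (minimalMatrices S)

/-- A one-qubit Clifford operation: a unitary mapping each of the three Pauli matrices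
to a Pauli matrix, up to sign, under conjugation. -/
def IsClifford (U : Matrix (Fin 2) (Fin 2) ℂ) : Prop :=
  U ∈ Matrix.unitaryGroup (Fin 2) ℂ ∧
    ∃ π : Equiv.Perm (Fin 3), ∀ u : Fin 3, ∃ s : ℂ, (s = 1 ∨ s = -1) ∧
      U * pauliMat u.succ * Uᴴ = s • pauliMat (π u).succ

/-- Local unitary equivalence of pure states. -/
def LUequiv (ψ φ : (ι → Fin 2) → ℂ) : Prop :=
  ∃ U : ι → Matrix (Fin 2) (Fin 2) ℂ,
    (∀ i, U i ∈ Matrix.unitaryGroup (Fin 2) ℂ) ∧ (kron U).mulVec ψ = φ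

/-- Local Clifford equivalence of pure states. -/
def LCequiv (ψ φ : (ι → Fin 2) → ℂ) : Prop :=
  ∃ U : ι → Matrix (Fin 2) (Fin 2) ℂ,
    (∀ i, IsClifford (U i)) ∧ (kron U).mulVec ψ = φ

/-- Local Clifford equivalence of (possibly mixed) states. -/
def LCequivMixed (ρ ρ' : Matrix (ι → Fin 2) (ι → Fin 2) ℂ) : Prop :=
  ∃ U : ι → Matrix (Fin 2) (Fin 2) ℂ,
    (∀ i, IsClifford (U i)) ∧ kron U * ρ * (kron U)ᴴ = ρ'

/-- A pure state is fully entangled if it is not a tensor product of states on two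
complementary nonempty subsets of the qubits. -/
def FullyEntangled (ψ : (ι → Fin 2) → ℂ) : Prop :=
  ¬ ∃ (ω : Finset ι) (φ : ({i // i ∈ ω} → Fin 2) → ℂ) (χ : ({i // i ∉ ω} → Fin 2) → ℂ),
      ω ≠ ∅ ∧ ω ≠ Finset.univ ∧
        ∀ x : ι → Fin 2, ψ x = φ (fun i => x i.1) * χ (fun i => x i.1)

/-- Recombine an assignment on `ω` and one on its complement into a global assignment. -/
def mergeAssign (ω : Finset ι) (x : {i // i ∈ ω} → Fin 2) (z : {i // i ∉ ω} → Fin 2) :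
    ι → Fin 2 :=
  fun i => if h : i ∈ ω then x ⟨i, h⟩ else z ⟨i, h⟩

/-- The reduced density matrix `ρ_ω(ψ)` of the pure state `ψ` on the qubits in `ω`
(partial trace of `|ψ⟩⟨ψ|` over the qubits outside `ω`). -/
def reducedState (ψ : (ι → Fin 2) → ℂ) (ω : Finset ι) :
    Matrix ({i // i ∈ ω} → Fin 2) ({i // i ∈ ω} → Fin 2) ℂ :=
  Matrix.of fun x y =>
    ∑ z : {i // i ∉ ω} → Fin 2, ψ (mergeAssign ω x z) * (starRingEnd ℂ) (ψ (mergeAssign ω y z))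

/-- The restriction `α_M M_{i₁} ⊗ ⋯ ⊗ M_{i_k}` of a Pauli operator to the qubits in `ω`. -/
def PauliOp.restrict (M : PauliOp ι) (ω : Finset ι) :
    Matrix ({i // i ∈ ω} → Fin 2) ({i // i ∈ ω} → Fin 2) ℂ :=
  M.phase • kron fun i : {i // i ∈ ω} => pauliMat (M.label i.1)

/-- The `n`-qubit GHZ state `(|0…0⟩ + |1…1⟩)/√2`. -/
def ghz (n : ℕ) : (Fin n → Fin 2) → ℂ :=
  fun x => if x = (fun _ => 0) ∨ x = (fun _ => 1) then ((Real.sqrt 2 : ℝ)⁻¹ : ℂ) else 0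

/-- The `2n × 2n` binary symplectic form `P = [[0, I], [I, 0]]`. -/
def Pmat (n : ℕ) : Matrix (Fin n ⊕ Fin n) (Fin n ⊕ Fin n) (ZMod 2) :=
  Matrix.fromBlocks 0 1 1 0

end

section Kron

variable {ι : Type} [Fintype ι]

theorem kron_mul [DecidableEq ι] (U V : ι → Matrix (Fin 2) (Fin 2) ℂ) :
    kron U * kron V = kron fun i => U i * V i := by
  ext x y
  simp only [kron, Matrix.mul_apply, Matrix.of_apply, ← Finset.prod_mul_distrib]
  exact (Fintype.prod_sum fun i b => U i (x i) b * V i b (y i)).symm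

theorem trace_kron [DecidableEq ι] (U : ι → Matrix (Fin 2) (Fin 2) ℂ) :
    (kron U).trace = ∏ i, (U i).trace := by
  simp only [kron, Matrix.trace, Matrix.diag_apply, Matrix.of_apply]
  exact (Fintype.prod_sum fun i b => U i b b).symm

theorem kron_one [DecidableEq ι] :
    kron (fun _ : ι => (1 : Matrix (Fin 2) (Fin 2) ℂ)) = 1 := by
  ext x y
  simp only [kron, Matrix.of_apply, Matrix.one_apply, Finset.prod_ite_zero, Finset.prod_const_one,
    Finset.mem_univ, true_imp_iff, funext_iff]

/-- An operator acting on the single qubit `i`. -/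
theorem kron_update_mulVec [DecidableEq ι] (i : ι) (A : Matrix (Fin 2) (Fin 2) ℂ)
    (ψ : (ι → Fin 2) → ℂ) (x : ι → Fin 2) :
    (kron (Function.update 1 i A)).mulVec ψ x = ∑ b, A (x i) b * ψ (Function.update x i b) := by
  symm
  refine Fintype.sum_of_injective (Function.update x i) (Function.update_injective x i) _ _ ?_ ?_
  · intro y hy
    have hne : ∃ k, k ≠ i ∧ x k ≠ y k := by
      by_contra! h
      refine hy ⟨y i, funext fun k => ?_⟩
      by_cases hk : k = i
      · subst hk; simp
      · simp [hk, h k hk]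
    obtain ⟨k, hk, hxy⟩ := hne
    refine mul_eq_zero_of_left (Finset.prod_eq_zero (Finset.mem_univ k) ?_) _
    simp [hk, hxy]
  · intro b
    simp only [kron, Matrix.of_apply]
    rw [Fintype.prod_eq_single i fun k hk => by simp [hk]]
    simp

theorem commute_kron_update [DecidableEq ι] (U : ι → Matrix (Fin 2) (Fin 2) ℂ) (i : ι)
    (A : Matrix (Fin 2) (Fin 2) ℂ) (h : U i * A = A * U i) :
    kron U * kron (Function.update 1 i A) = kron (Function.update 1 i A) * kron U := by
  rw [kron_mul, kron_mul]
  congr 1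
  funext k
  by_cases hk : k = i
  · subst hk; simpa using h
  · simp [hk]

end Kron

theorem pauliMat_mul_self (u : Fin 4) : pauliMat u * pauliMat u = 1 := by
  fin_cases u <;> ext a b <;> fin_cases a <;> fin_cases b <;>
    simp [pauliMat, Matrix.mul_apply]

theorem trace_pauliMat {u : Fin 4} (hu : u ≠ 0) : (pauliMat u).trace = 0 := by
  fin_cases u <;> simp_all [pauliMat, Matrix.trace]

theorem eq_of_trace_pauliMat_mul_ne_zero {u v : Fin 4}
    (h : (pauliMat u * pauliMat v).trace ≠ 0) : u = v := by
  fin_cases u <;> fin_cases v <;> simp [pauliMat, Matrix.trace] at h ⊢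

theorem ne_of_trace_pauliMat_mul_ne_zero {k u v : Fin 4} (hu : u ≠ 0) (hv : v ≠ 0) (huv : u ≠ v)
    (h : (pauliMat k * (pauliMat u * pauliMat v)).trace ≠ 0) : k ≠ 0 ∧ k ≠ u ∧ k ≠ v := by
  fin_cases k <;> fin_cases u <;> fin_cases v <;>
    simp [pauliMat, Matrix.trace, Fin.sum_univ_two] at hu hv huv h ⊢

/-- The eigenspaces of a nontrivial Pauli matrix are at most one-dimensional. -/
theorem exists_eigenvector_pauliMat {v : Fin 4} (hv : v ≠ 0) (c : ℂ) :
    ∃ (φ : Fin 2 → ℂ) (j : Fin 2), ∀ w : Fin 2 → ℂ,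
      (∀ a, ∑ b, pauliMat v a b * w b = c * w a) → ∀ a, w a = φ a * w j := by
  fin_cases v
  · exact absurd rfl hv
  · refine ⟨![1, c], 0, fun w hw a => ?_⟩
    have h0 : w 1 = c * w 0 := by simpa [pauliMat, Fin.sum_univ_two] using hw 0
    fin_cases a
    · simp
    · simpa using h0
  · refine ⟨![1, Complex.I * c], 0, fun w hw a => ?_⟩
    have h0 : -(Complex.I * w 1) = c * w 0 := by
      simpa [pauliMat, Fin.sum_univ_two] using hw 0
    fin_cases a
    · simp
    · simp only [Fin.mk_one, Matrix.cons_val_one, Matrix.cons_val_fin_one]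
      linear_combination Complex.I * h0 + w 1 * Complex.I_mul_I
  · have key : ∀ w : Fin 2 → ℂ, (∀ a, ∑ b, pauliMat 3 a b * w b = c * w a) →
        w 0 = c * w 0 ∧ -w 1 = c * w 1 := fun w hw =>
      ⟨by simpa [pauliMat, Fin.sum_univ_two] using hw 0,
        by simpa [pauliMat, Fin.sum_univ_two] using hw 1⟩
    by_cases hc : c = 1
    · refine ⟨![1, 0], 0, fun w hw a => ?_⟩
      have h1 := (key w hw).2
      fin_cases a
      · simp
      · simp only [Fin.mk_one, Matrix.cons_val_one, Matrix.cons_val_fin_one]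
        rw [hc] at h1
        linear_combination (-1 / 2) * h1
    · refine ⟨![0, 1], 1, fun w hw a => ?_⟩
      have h1 : (1 - c) * w 0 = 0 := by linear_combination (key w hw).1
      fin_cases a
      · simpa [sub_eq_zero, Ne.symm hc] using h1
      · simp

section PauliOp

variable {ι : Type} [Fintype ι] [DecidableEq ι]

theorem PauliOp.phase_ne_zero {ι : Type} (M : PauliOp ι) : M.phase ≠ 0 := by
  rcases M.phase_ok with h | h | h | h <;> simp [h]

theorem PauliOp.toMatrix_mul_self (M : PauliOp ι) :
    M.toMatrix * M.toMatrix = M.phase ^ 2 • 1 := by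
  simp [PauliOp.toMatrix, kron_mul, pauliMat_mul_self, kron_one, smul_smul, sq]

theorem PauliOp.isUnit_toMatrix (M : PauliOp ι) : IsUnit M.toMatrix := by
  refine IsUnit.of_mul_eq_one ((M.phase ^ 2)⁻¹ • M.toMatrix) ?_
  rw [mul_smul_comm, M.toMatrix_mul_self, smul_smul,
    inv_mul_cancel₀ (pow_ne_zero 2 M.phase_ne_zero), one_smul]

theorem PauliOp.trace_toMatrix_mul_self_ne_zero (M : PauliOp ι) :
    (M.toMatrix * M.toMatrix).trace ≠ 0 := by
  rw [M.toMatrix_mul_self, Matrix.trace_smul, Matrix.trace_one]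
  simp [M.phase_ne_zero]

theorem PauliOp.toMatrix_injective :
    Function.Injective (PauliOp.toMatrix : PauliOp ι → Matrix (ι → Fin 2) (ι → Fin 2) ℂ) := by
  intro M N h
  have htr := M.trace_toMatrix_mul_self_ne_zero
  nth_rewrite 2 [h] at htr
  have hlabel : M.label = N.label := by
    simp only [PauliOp.toMatrix, smul_mul_smul_comm, kron_mul, Matrix.trace_smul, trace_kron,
      smul_eq_mul] at htr
    exact funext fun i => eq_of_trace_pauliMat_mul_ne_zero
      (Finset.prod_ne_zero_iff.mp (right_ne_zero_of_mul htr) i (Finset.mem_univ i))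
  have hphase : M.phase = N.phase := by
    have hk : kron (fun i => pauliMat (M.label i)) ≠ 0 := by
      intro h0
      exact M.trace_toMatrix_mul_self_ne_zero (by simp [PauliOp.toMatrix, h0])
    rw [PauliOp.toMatrix, PauliOp.toMatrix, ← hlabel] at h
    exact smul_left_injective ℂ hk h
  cases M; cases N
  simp_all

theorem PauliOp.label_of_toMatrix_eq_mul {K M N : PauliOp ι}
    (h : K.toMatrix = M.toMatrix * N.toMatrix) (i : ι) (hM : M.label i ≠ 0) (hN : N.label i ≠ 0)
    (hMN : M.label i ≠ N.label i) :
    K.label i ≠ 0 ∧ K.label i ≠ M.label i ∧ K.label i ≠ N.label i := by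
  have htr := K.trace_toMatrix_mul_self_ne_zero
  nth_rewrite 2 [h] at htr
  simp only [PauliOp.toMatrix, smul_mul_smul_comm, kron_mul, Matrix.trace_smul, trace_kron,
    smul_eq_mul] at htr
  exact ne_of_trace_pauliMat_mul_ne_zero hM hN hMN
    (Finset.prod_ne_zero_iff.mp (right_ne_zero_of_mul htr) i (Finset.mem_univ i))

theorem PauliOp.trace_toMatrix_eq_zero {M : PauliOp ι} {i : ι} (h : M.label i ≠ 0) :
    M.toMatrix.trace = 0 := by
  rw [PauliOp.toMatrix, Matrix.trace_smul, trace_kron,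
    Finset.prod_eq_zero (Finset.mem_univ i) (trace_pauliMat h), smul_zero]

end PauliOp

section Stabilizer

variable {ι : Type} [Fintype ι] [DecidableEq ι]

theorem Stabilizer.toMatrix_mul_sum (S : Stabilizer ι) {M : PauliOp ι} (hM : M ∈ S.elems) :
    M.toMatrix * ∑ N ∈ S.elems, N.toMatrix = ∑ N ∈ S.elems, N.toMatrix := by
  choose! f hf hfM using S.mul_mem M hM
  have hinj : Set.InjOn f S.elems := by
    intro N hN N' hN' h
    refine PauliOp.toMatrix_injective (M.isUnit_toMatrix.mul_left_cancel ?_)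
    rw [← hfM N hN, ← hfM N' hN', h]
  rw [Finset.mul_sum]
  refine Finset.sum_nbij f hf hinj ?_ fun N hN => (hfM N hN).symm
  exact Finset.surjOn_of_injOn_of_card_le f hf hinj le_rfl

theorem Stabilizer.trace_sum (S : Stabilizer ι) {ψ : (ι → Fin 2) → ℂ} (hψ : stabilizesState S ψ) :
    (∑ N ∈ S.elems, N.toMatrix).trace = 2 ^ Fintype.card ι := by
  obtain ⟨E, hE, hE1⟩ := S.one_mem
  rw [Matrix.trace_sum, Finset.sum_eq_single_of_mem E hE]
  · simp [hE1]
  · intro M hM hne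
    by_contra htr
    have hlabel : ∀ i, M.label i = 0 := fun i => by
      by_contra h
      exact htr (PauliOp.trace_toMatrix_eq_zero h)
    have hmat : M.toMatrix = M.phase • 1 := by
      simp [PauliOp.toMatrix, hlabel, pauliMat, kron_one]
    have hψ0 : ψ ≠ 0 := by
      rintro rfl
      simpa using hψ.1
    have hfix : M.phase • ψ = (1 : ℂ) • ψ := by
      simpa [hmat, Matrix.smul_mulVec] using hψ.2 M hM
    have hphase : M.phase = 1 := smul_left_injective ℂ hψ0 hfix
    exact hne (PauliOp.toMatrix_injective (by rw [hmat, hphase, one_smul, hE1]))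

/-- The stabilizer state is the unique vector fixed by the stabilizer, up to a scalar. -/
theorem Stabilizer.exists_smul_eq_of_fixed (S : Stabilizer ι) {ψ φ : (ι → Fin 2) → ℂ}
    (hψ : stabilizesState S ψ) (hφ : ∀ M ∈ S.elems, M.toMatrix.mulVec φ = φ) :
    ∃ c : ℂ, c • ψ = φ := by
  set d : ℂ := 2 ^ Fintype.card ι with hd
  have hd0 : d ≠ 0 := pow_ne_zero _ two_ne_zero
  have hcard : (S.elems.card : ℂ) = d := by simp [S.card_elems, hd]
  set Q := d⁻¹ • ∑ N ∈ S.elems, N.toMatrix with hQ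
  have hmul : ∀ M ∈ S.elems, M.toMatrix * Q = Q := fun M hM => by
    rw [hQ, mul_smul_comm, S.toMatrix_mul_sum hM]
  have hfix : ∀ w : (ι → Fin 2) → ℂ, (∀ M ∈ S.elems, M.toMatrix.mulVec w = w) →
      Q.mulVec w = w := fun w hw => by
    rw [hQ, Matrix.smul_mulVec, Matrix.sum_mulVec, Finset.sum_congr rfl hw, Finset.sum_const,
      ← Nat.cast_smul_eq_nsmul ℂ, hcard, smul_smul, inv_mul_cancel₀ hd0, one_smul]
  have hproj : LinearMap.IsProj (LinearMap.range (Matrix.toLin' Q)) (Matrix.toLin' Q) := by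
    refine ⟨fun w => LinearMap.mem_range_self _ w, ?_⟩
    rintro _ ⟨w, rfl⟩
    simp only [Matrix.toLin'_apply]
    refine hfix _ fun M hM => ?_
    rw [Matrix.mulVec_mulVec, hmul M hM]
  have hrank : Module.finrank ℂ (LinearMap.range (Matrix.toLin' Q)) = 1 := by
    have h := hproj.trace
    rw [Matrix.trace_toLin'_eq, hQ, Matrix.trace_smul, S.trace_sum hψ, ← hd, smul_eq_mul,
      inv_mul_cancel₀ hd0] at h
    exact_mod_cast h.symm
  have hmem : ∀ w : (ι → Fin 2) → ℂ, (∀ M ∈ S.elems, M.toMatrix.mulVec w = w) →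
      w ∈ LinearMap.range (Matrix.toLin' Q) := fun w hw =>
    ⟨w, by rw [Matrix.toLin'_apply, hfix w hw]⟩
  have hψ0 : (⟨ψ, hmem ψ hψ.2⟩ : LinearMap.range (Matrix.toLin' Q)) ≠ 0 := by
    intro h
    have h0 : ψ = 0 := congrArg Subtype.val h
    simpa [h0] using hψ.1
  obtain ⟨c, hc⟩ := (finrank_eq_one_iff_of_nonzero' _ hψ0).mp hrank ⟨φ, hmem φ hφ⟩
  exact ⟨c, congrArg Subtype.val hc⟩

/-- If a Pauli matrix does not occur on qubit `i`, then some nontrivial Pauli matrix commutes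
with all the matrices that do occur there. -/
theorem Stabilizer.exists_pauliMat_commute (S : Stabilizer ι) {i : ι} {u : Fin 4} (hu : u ≠ 0)
    (h : ∀ M ∈ S.elems, M.label i ≠ u) :
    ∃ v : Fin 4, v ≠ 0 ∧ ∀ M ∈ S.elems,
      pauliMat (M.label i) * pauliMat v = pauliMat v * pauliMat (M.label i) := by
  by_cases hall : ∀ M ∈ S.elems, M.label i = 0
  · exact ⟨u, hu, fun M hM => by simp [hall M hM, pauliMat]⟩
  push Not at hall
  obtain ⟨N, hN, hN0⟩ := hall
  refine ⟨N.label i, hN0, fun M hM => ?_⟩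
  by_cases hM0 : M.label i = 0
  · simp [hM0, pauliMat]
  by_cases hMN : M.label i = N.label i
  · rw [hMN]
  obtain ⟨K, hK, hKMN⟩ := S.mul_mem M hM N hN
  have hlabel := PauliOp.label_of_toMatrix_eq_mul hKMN i hM0 hN0 hMN
  have hKu := h K hK
  have hMu := h M hM
  have hNu := h N hN
  omega

theorem Stabilizer.exists_smul_eq_kron_update_mulVec (S : Stabilizer ι) {ψ : (ι → Fin 2) → ℂ}
    (hψ : stabilizesState S ψ) {i : ι} {A : Matrix (Fin 2) (Fin 2) ℂ}
    (hA : ∀ M ∈ S.elems, pauliMat (M.label i) * A = A * pauliMat (M.label i)) :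
    ∃ c : ℂ, c • ψ = (kron (Function.update 1 i A)).mulVec ψ := by
  refine S.exists_smul_eq_of_fixed hψ fun M hM => ?_
  have hcomm : M.toMatrix * kron (Function.update 1 i A) =
      kron (Function.update 1 i A) * M.toMatrix := by
    rw [PauliOp.toMatrix, smul_mul_assoc,
      commute_kron_update (fun k => pauliMat (M.label k)) i A (hA M hM), mul_smul_comm]
  rw [Matrix.mulVec_mulVec, hcomm, ← Matrix.mulVec_mulVec, hψ.2 M hM]

end Stabilizer

/-- An eigenvector of a nontrivial Pauli matrix on qubit `i` is not fully entangled. -/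
theorem not_fullyEntangled_of_kron_update_mulVec {ι : Type} [Fintype ι] [DecidableEq ι]
    [Nontrivial ι] {ψ : (ι → Fin 2) → ℂ} {i : ι} {v : Fin 4} (hv : v ≠ 0) {c : ℂ}
    (h : c • ψ = (kron (Function.update 1 i (pauliMat v))).mulVec ψ) : ¬ FullyEntangled ψ := by
  obtain ⟨φ, j, hφ⟩ := exists_eigenvector_pauliMat hv c
  refine not_not_intro ⟨{i}, fun y => φ (y ⟨i, Finset.mem_singleton_self i⟩),
    fun z => ψ (mergeAssign {i} (fun _ => j) z), Finset.singleton_ne_empty i, ?_, fun x => ?_⟩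
  · intro huniv
    obtain ⟨k, hk⟩ := exists_ne i
    exact hk (Finset.mem_singleton.mp (huniv ▸ Finset.mem_univ k))
  · have hw := hφ (fun b => ψ (Function.update x i b)) fun a => by
      have ha := congrFun h (Function.update x i a)
      rw [kron_update_mulVec] at ha
      simpa using ha.symm
    have hmerge : mergeAssign {i} (fun _ => j) (fun k => x k.1) = Function.update x i j := by
      funext k
      by_cases hk : k = i
      · subst hk; simp [mergeAssign]
      · simp [mergeAssign, hk]
    have hx := hw (x i)
    rw [Function.update_eq_self] at hx
    rwa [← hmerge] at hx

/-- In the stabilizer of a fully entangled stabilizer state on `n ≥ 2`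
qubits, all three Pauli matrices `σₓ, σ_y, σ_z` occur on every qubit. -/
theorem stmt_7 {n : ℕ} (hn : 2 ≤ n) (S : Stabilizer (Fin n)) (ψ : (Fin n → Fin 2) → ℂ)
    (hψ : stabilizesState S ψ) (hent : FullyEntangled ψ) :
    ∀ i : Fin n, ∀ u : Fin 4, u ≠ 0 → ∃ M ∈ S.elems, M.label i = u := by
  intro i u hu
  by_contra! hno
  obtain ⟨v, hv, hcomm⟩ := S.exists_pauliMat_commute hu hno
  obtain ⟨c, hc⟩ := S.exists_smul_eq_kron_update_mulVec hψ hcomm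
  have : Nontrivial (Fin n) := Fin.nontrivial_iff_two_le.mpr hn
  exact not_fullyEntangled_of_kron_update_mulVec hv hc hent
end

section
/- Let |ψ⟩ be a stabilizer state on n qubits with binary generator matrix S = [S_zᵀ S_xᵀ]ᵀ, where S_z and S_x are n×n matrices over GF(2). Then the binary stabilizer space 𝒞_S (the column space of S) is GF(4)-linear if and only if S_zᵀ S_z + S_xᵀ S_x + S_zᵀ S_x = 0 over GF(2). -/
open Matrix

/-- Multiplication by the GF(4) scalar `ξ`, as the binary matrix `[[0, I], [I, I]]`
acting on `𝔽₂^{2n}` (first block = z-part, second block = x-part). -/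
def xiMat (n : ℕ) : Matrix (Fin n ⊕ Fin n) (Fin n ⊕ Fin n) (ZMod 2) :=
  Matrix.fromBlocks 0 1 1 1

/-- The binary symplectic form is an involution. -/
lemma Pmat_mul_self (n : ℕ) : Pmat n * Pmat n = 1 := by
  simp [Pmat, Matrix.fromBlocks_multiply, Matrix.fromBlocks_one]

/-- The column space of a full-rank isotropic `2n × n` matrix is self-dual for the
symplectic form. -/
lemma range_mulVecLin_eq_ker {n : ℕ} (S : Matrix (Fin n ⊕ Fin n) (Fin n) (ZMod 2))
    (hbasis : LinearIndependent (ZMod 2) S.col) (hiso : Sᵀ * Pmat n * S = 0) :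
    LinearMap.range S.mulVecLin = LinearMap.ker (Sᵀ * Pmat n).mulVecLin := by
  have hS : S.rank = n := by simpa using hbasis.rank_matrix
  have hdual : (Sᵀ * Pmat n).rank = n := by
    rw [Matrix.rank_mul_eq_left_of_isUnit_det, Matrix.rank_transpose, hS]
    exact Matrix.isUnit_det_of_left_inverse (Pmat_mul_self n)
  apply Submodule.eq_of_le_of_finrank_eq
  · rw [LinearMap.range_le_ker_iff, ← Matrix.mulVecLin_mul, hiso, Matrix.mulVecLin_zero]
  · have h := (Sᵀ * Pmat n).mulVecLin.finrank_range_add_finrank_ker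
    rw [Module.finrank_pi, Fintype.card_sum, Fintype.card_fin] at h
    unfold Matrix.rank at hS hdual
    omega

/-- The symplectic Gram matrix of `S` against its multiple by the GF(4) scalar `ξ`. -/
lemma transpose_mul_Pmat_mul_xiMat_mul {n : ℕ}
    (S : Matrix (Fin n ⊕ Fin n) (Fin n) (ZMod 2)) :
    Sᵀ * Pmat n * (xiMat n * S) =
      (S.submatrix Sum.inl id)ᵀ * (S.submatrix Sum.inl id)
        + (S.submatrix Sum.inr id)ᵀ * (S.submatrix Sum.inr id)
        + (S.submatrix Sum.inl id)ᵀ * (S.submatrix Sum.inr id) := by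
  have hS : S = Matrix.fromRows (S.submatrix Sum.inl id) (S.submatrix Sum.inr id) := by
    ext (i | i) j <;> rfl
  generalize S.submatrix Sum.inl id = Z at *
  generalize S.submatrix Sum.inr id = X at *
  subst hS
  rw [Matrix.mul_assoc, ← Matrix.mul_assoc (Pmat n)]
  simp only [Pmat, xiMat, Matrix.fromBlocks_multiply, Matrix.transpose_fromRows,
    Matrix.fromBlocks_mul_fromRows, Matrix.fromCols_mul_fromRows, Matrix.mul_add,
    Matrix.one_mul, Matrix.zero_mul, zero_add, add_zero]
  abel

/-- A binary stabilizer space `𝒞_S` with generator matrix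
`S = [S_zᵀ S_xᵀ]ᵀ` is GF(4)-linear iff `S_zᵀ S_z + S_xᵀ S_x + S_zᵀ S_x = 0` over GF(2). -/
theorem stmt_8 {n : ℕ} (S : Matrix (Fin n ⊕ Fin n) (Fin n) (ZMod 2))
    (hbasis : LinearIndependent (ZMod 2) (fun j : Fin n => fun i => S i j))
    (hiso : Sᵀ * Pmat n * S = 0) :
    (∀ v ∈ LinearMap.range S.mulVecLin, (xiMat n).mulVec v ∈ LinearMap.range S.mulVecLin) ↔
      (S.submatrix Sum.inl id)ᵀ * (S.submatrix Sum.inl id)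
        + (S.submatrix Sum.inr id)ᵀ * (S.submatrix Sum.inr id)
        + (S.submatrix Sum.inl id)ᵀ * (S.submatrix Sum.inr id) = 0 := by
  rw [← transpose_mul_Pmat_mul_xiMat_mul]
  conv_lhs =>
    enter [v, hv]
    rw [range_mulVecLin_eq_ker S hbasis hiso]
  rw [← Matrix.mulVec_injective.eq_iff, funext_iff]
  generalize Sᵀ * Pmat n = D
  simp [Matrix.mulVec_mulVec, Matrix.mul_assoc]
end
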